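/- Enabling equivalence forces marking equality on adapted CP-subnets: let (N,μ₀) be a perpetual free-choice system with regeneration cluster cl, let N̂ ⊆ N be a cl-adapted CP-subnet, and let (μ₁,μ₂) be reachable markings of (N,μ₀) whose restrictions μ̂ⱼ = μⱼ|N̂ to the places of N̂ satisfy en(N̂,μ̂₁) = en(N̂,μ̂₂). Then μ̂₁ = μ̂₂. -/

import Mathlib

open Classical

/-- A (finite, bipartite) Petri *net*: disjoint finite sets of places and
transitions, and an edge relation running only between places and transitions. -/
structure Net (α : Type*) where
  places : Finset α
  transitions : Finset α
  F : α → α → Prop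
  disj : Disjoint places transitions
  edges : ∀ x y, F x y →
    (x ∈ places ∧ y ∈ transitions) ∨ (x ∈ transitions ∧ y ∈ places)

namespace Net

variable {α : Type*} [DecidableEq α]

/-- The nodes of a net. -/
def nodes (N : Net α) : Finset α := N.places ∪ N.transitions

/-- Pre-set of a node. -/
def pre (N : Net α) (x : α) : Set α := {y | N.F y x}

/-- Post-set of a node. -/
def post (N : Net α) (x : α) : Set α := {y | N.F x y}

/-- A transition `t` is enabled at a marking `μ` if every pre-place is marked. -/
def Enabled (N : Net α) (μ : α → ℕ) (t : α) : Prop :=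
  t ∈ N.transitions ∧ ∀ p, N.F p t → 1 ≤ μ p

/-- Firing a transition: remove one token from each pre-place,
add one token at each post-place. -/
noncomputable def fire (N : Net α) (t : α) (μ : α → ℕ) : α → ℕ :=
  fun p => μ p - (if N.F p t then 1 else 0) + (if N.F t p then 1 else 0)

/-- `FireSeq N μ σ ν`: the occurrence sequence `σ` is enabled at `μ` and
firing it successively leads from `μ` to `ν`. -/
inductive FireSeq (N : Net α) : (α → ℕ) → List α → (α → ℕ) → Prop
  | nil (μ : α → ℕ) : FireSeq N μ [] μ
  | cons {μ ν : α → ℕ} {t : α} {σ : List α} :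
      N.Enabled μ t → FireSeq N (N.fire t μ) σ ν → FireSeq N μ (t :: σ) ν

/-- Reachability of markings. -/
def Reach (N : Net α) (μ ν : α → ℕ) : Prop := ∃ σ : List α, N.FireSeq μ σ ν

/-- The set of transitions enabled at `μ`. -/
def en (N : Net α) (μ : α → ℕ) : Set α := {t | N.Enabled μ t}

/-- Equality of markings (as maps on the places of the net). -/
def MarkingEq (N : Net α) (μ ν : α → ℕ) : Prop := ∀ p ∈ N.places, μ p = ν p

/-- Liveness of a Petri net `(N, μ₀)`. -/
def Live (N : Net α) (μ₀ : α → ℕ) : Prop :=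
  ∀ t ∈ N.transitions, ∀ μ, N.Reach μ₀ μ → ∃ ν, N.Reach μ ν ∧ N.Enabled ν t

/-- Boundedness of a Petri net `(N, μ₀)`. -/
def Bounded (N : Net α) (μ₀ : α → ℕ) : Prop :=
  ∃ K : ℕ, ∀ μ, N.Reach μ₀ μ → ∀ p ∈ N.places, μ p ≤ K

/-- A net is well-formed if it carries a live and bounded marking. -/
def WellFormed (N : Net α) : Prop := ∃ μ₀ : α → ℕ, N.Live μ₀ ∧ N.Bounded μ₀

/-- Free-choice net: `(p,t) ∈ F` implies `•t × p• ⊆ F`. -/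
def FreeChoice (N : Net α) : Prop :=
  ∀ p ∈ N.places, ∀ t, N.F p t → ∀ p', N.F p' t → ∀ t', N.F p t' → N.F p' t'

/-- T-net: every place has exactly one pre-transition and one post-transition. -/
def IsTNet (N : Net α) : Prop :=
  ∀ p ∈ N.places, (∃! t, N.F t p) ∧ (∃! t, N.F p t)

/-- A set of nodes is cluster-closed if with each place it contains the
post-set of the place and with each transition the pre-set of the transition. -/
def ClusterClosed (N : Net α) (S : Set α) : Prop :=
  (∀ p ∈ S, p ∈ N.places → ∀ t, N.F p t → t ∈ S) ∧
  (∀ t ∈ S, t ∈ N.transitions → ∀ p, N.F p t → p ∈ S)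

/-- The cluster of a node: the smallest cluster-closed set of nodes containing it. -/
def clusterOf (N : Net α) (x : α) : Set α :=
  ⋂₀ {S : Set α | x ∈ S ∧ N.ClusterClosed S}

/-- `cl` is a cluster of `N` if it is the cluster of some node. -/
def IsCluster (N : Net α) (cl : Set α) : Prop :=
  ∃ x ∈ N.nodes, cl = N.clusterOf x

/-- The marking `μ_cl` marking exactly the places of the cluster `cl`, once. -/
noncomputable def clusterMarking (N : Net α) (cl : Set α) : α → ℕ :=
  fun p => if p ∈ cl ∧ p ∈ N.places then 1 else 0

/-- `μh` is a home marking of `(N, μ₀)`: reachable from every reachable marking. -/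
def IsHomeMarking (N : Net α) (μ₀ μh : α → ℕ) : Prop :=
  ∀ μ, N.Reach μ₀ μ → ∃ ν, N.Reach μ ν ∧ N.MarkingEq ν μh

/-- `(N, μ₀)` is perpetual with regeneration cluster `cl`: live, bounded, and
`μ_cl` is a home marking for the cluster `cl`. -/
def Perpetual (N : Net α) (μ₀ : α → ℕ) (cl : Set α) : Prop :=
  N.Live μ₀ ∧ N.Bounded μ₀ ∧ N.IsCluster cl ∧
    N.IsHomeMarking μ₀ (N.clusterMarking cl)

/-- Lucency: enabling-equivalent reachable markings are equal. -/
def Lucent (N : Net α) (μ₀ : α → ℕ) : Prop :=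
  ∀ μ₁ μ₂, N.Reach μ₀ μ₁ → N.Reach μ₀ μ₂ → N.en μ₁ = N.en μ₂ → N.MarkingEq μ₁ μ₂

/-- A path of the net: a nonempty sequence of nodes along edges. -/
def IsPath (N : Net α) (δ : List α) : Prop :=
  δ ≠ [] ∧ (∀ x ∈ δ, x ∈ N.nodes) ∧ δ.Chain' N.F

/-- A circuit: a path whose last node is connected back to its first node. -/
def IsCircuit (N : Net α) (δ : List α) : Prop :=
  N.IsPath δ ∧ ∃ h : δ ≠ [], N.F (δ.getLast h) (δ.head h)

/-- Token count of a set of nodes: total number of tokens on its places. -/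
def tokenCount (N : Net α) (μ : α → ℕ) (X : Finset α) : ℕ :=
  ∑ p ∈ X ∩ N.places, μ p

/-- The set `S` of nodes is strongly connected (in the induced subnet). -/
def StronglyConnectedOn (N : Net α) (S : Finset α) : Prop :=
  ∀ x ∈ S, ∀ y ∈ S,
    Relation.ReflTransGen (fun a b => a ∈ S ∧ b ∈ S ∧ N.F a b) x y

/-- The set `S` of nodes is weakly connected (in the induced subnet). -/
def WeaklyConnectedOn (N : Net α) (S : Finset α) : Prop :=
  ∀ x ∈ S, ∀ y ∈ S,
    Relation.ReflTransGen (fun a b => a ∈ S ∧ b ∈ S ∧ (N.F a b ∨ N.F b a)) x y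

/-- The (full) subnet spanned by `S` is transition-bordered: every place of `S`
has all its neighbours inside `S`. -/
def TransitionBordered (N : Net α) (S : Finset α) : Prop :=
  ∀ p ∈ S, p ∈ N.places → ∀ y, (N.F y p ∨ N.F p y) → y ∈ S

/-- The full subnet spanned by `S` is a T-net: each place of `S` has exactly one
pre-transition and one post-transition inside `S`. -/
def TNetOn (N : Net α) (S : Finset α) : Prop :=
  ∀ p ∈ S, p ∈ N.places →
    (∃! t, t ∈ S ∧ N.F t p) ∧ (∃! t, t ∈ S ∧ N.F p t)

/-- `S` spans a CP-subnet of `N`: nonempty, weakly connected, transition-bordered,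
a T-net, and the complement contains a transition and is strongly connected. -/
def IsCPSubnet (N : Net α) (S : Finset α) : Prop :=
  S.Nonempty ∧ S ⊆ N.nodes ∧ N.WeaklyConnectedOn S ∧ N.TransitionBordered S ∧
  N.TNetOn S ∧ ((N.nodes \ S) ∩ N.transitions).Nonempty ∧
  N.StronglyConnectedOn (N.nodes \ S)

/-- The full subnet of `N` spanned by the node set `S`, as a net. -/
def restrict (N : Net α) (S : Finset α) : Net α where
  places := N.places ∩ S
  transitions := N.transitions ∩ S
  F := fun x y => x ∈ S ∧ y ∈ S ∧ N.F x y
  disj := N.disj.mono Finset.inter_subset_left Finset.inter_subset_left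
  edges := by
    rintro x y ⟨hx, hy, hF⟩
    rcases N.edges x y hF with ⟨h1, h2⟩ | ⟨h1, h2⟩
    · exact Or.inl ⟨Finset.mem_inter.mpr ⟨h1, hx⟩, Finset.mem_inter.mpr ⟨h2, hy⟩⟩
    · exact Or.inr ⟨Finset.mem_inter.mpr ⟨h1, hx⟩, Finset.mem_inter.mpr ⟨h2, hy⟩⟩

/-- A CP-exhaustion: a family of pairwise disjoint CP-subnets whose complement
is a strongly connected T-net. -/
def IsCPExhaustion (N : Net α) {n : ℕ}
    (Nhat : Fin n → Finset α) : Prop :=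
  (∀ i, N.IsCPSubnet (Nhat i)) ∧
  (∀ i j, i ≠ j → Disjoint (Nhat i) (Nhat j)) ∧
  N.StronglyConnectedOn (N.nodes \ Finset.univ.biUnion Nhat) ∧
  N.TNetOn (N.nodes \ Finset.univ.biUnion Nhat)

/-- `t` is a way-in transition of the subnet spanned by `S`: a transition of `S`
with a pre-place outside `S`. -/
def IsWayIn (N : Net α) (S : Finset α) (t : α) : Prop :=
  t ∈ S ∧ t ∈ N.transitions ∧ ∃ p ∈ N.places, p ∉ S ∧ N.F p t

/-- A shutdown sequence for the subnet spanned by `S` (with way-in transition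
`tin`) at a marking `μ`: an occurrence sequence enabled at `μ` using only
transitions of `S` other than `tin`, after which no transition of `S` other
than (possibly) `tin` is enabled. -/
def IsShutdownSeq (N : Net α) (S : Finset α) (tin : α)
    (μ : α → ℕ) (σ : List α) (μsd : α → ℕ) : Prop :=
  N.FireSeq μ σ μsd ∧
  (∀ t ∈ σ, t ∈ S ∧ t ∈ N.transitions ∧ t ≠ tin) ∧
  (∀ t ∈ S, t ∈ N.transitions → t ≠ tin → ¬ N.Enabled μsd t)

/-- `C` spans a P-component of `N`: nonempty, strongly connected, inside `C`
every transition has exactly one pre-place and one post-place, and every place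
of `C` has all its neighbours inside `C`. -/
def IsPComponent (N : Net α) (C : Finset α) : Prop :=
  C.Nonempty ∧ C ⊆ N.nodes ∧ N.StronglyConnectedOn C ∧
  (∀ t ∈ C, t ∈ N.transitions →
    (∃! p, p ∈ C ∧ N.F p t) ∧ (∃! p, p ∈ C ∧ N.F t p)) ∧
  (∀ p ∈ C, p ∈ N.places → ∀ y, (N.F y p ∨ N.F p y) → y ∈ C)

end Net

namespace Net

variable {α : Type*} {N : Net α} {μ₀ μ ν : α → ℕ} {cl : Set α} {S : Finset α}

theorem transition_of_place_edge {p t : α} (h : N.F p t) (hp : p ∈ N.places) :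
    t ∈ N.transitions := by
  rcases N.edges p t h with h' | h'
  · exact h'.2
  · exact absurd h'.1 (Finset.disjoint_left.1 N.disj hp)

theorem place_of_edge_transition {p t : α} (h : N.F p t) (ht : t ∈ N.transitions) :
    p ∈ N.places := by
  rcases N.edges p t h with h' | h'
  · exact h'.1
  · exact absurd ht (Finset.disjoint_left.1 N.disj h'.2)

theorem place_of_transition_edge {t p : α} (h : N.F t p) (ht : t ∈ N.transitions) :
    p ∈ N.places := by
  rcases N.edges t p h with h' | h'
  · exact absurd ht (Finset.disjoint_left.1 N.disj h'.1)
  · exact h'.2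

theorem transition_of_edge_place {t p : α} (h : N.F t p) (hp : p ∈ N.places) :
    t ∈ N.transitions := by
  rcases N.edges t p h with h' | h'
  · exact absurd h'.2 (Finset.disjoint_left.1 N.disj hp)
  · exact h'.1

/-- In a free-choice net two places sharing an output transition have the same outputs. -/
theorem FreeChoice.post_subset (hfc : N.FreeChoice) {p q t u : α} (hp : p ∈ N.places)
    (hpt : N.F p t) (hqt : N.F q t) (hpu : N.F p u) : N.F q u :=
  hfc p hp t hpt q hqt u hpu

/-! ### Occurrence sequences -/

theorem FireSeq.append {σ τ : List α} {ξ : α → ℕ} (h : N.FireSeq μ σ ν)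
    (h' : N.FireSeq ν τ ξ) : N.FireSeq μ (σ ++ τ) ξ := by
  induction h with
  | nil => exact h'
  | cons ht _ ih => exact .cons ht (ih h')

theorem FireSeq.of_append {σ τ : List α} (h : N.FireSeq μ (σ ++ τ) ν) :
    ∃ ξ, N.FireSeq μ σ ξ ∧ N.FireSeq ξ τ ν := by
  induction σ generalizing μ with
  | nil => exact ⟨μ, .nil μ, h⟩
  | cons t σ ih =>
    cases h with
    | cons ht h' =>
      obtain ⟨ξ, h₁, h₂⟩ := ih h'
      exact ⟨ξ, .cons ht h₁, h₂⟩

theorem FireSeq.single {t : α} (ht : N.Enabled μ t) : N.FireSeq μ [t] (N.fire t μ) :=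
  .cons ht (.nil _)

theorem Reach.trans {ξ : α → ℕ} (h : N.Reach μ ν) (h' : N.Reach ν ξ) : N.Reach μ ξ := by
  obtain ⟨σ, hσ⟩ := h
  obtain ⟨τ, hτ⟩ := h'
  exact ⟨_, hσ.append hτ⟩

theorem Reach.fire {t : α} (h : N.Reach μ ν) (ht : N.Enabled ν t) : N.Reach μ (N.fire t ν) :=
  h.trans ⟨_, .single ht⟩

theorem FireSeq.mem_transitions {σ : List α} (h : N.FireSeq μ σ ν) :
    ∀ t ∈ σ, t ∈ N.transitions := by
  induction h with
  | nil => simp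
  | cons ht _ ih =>
    intro t h'
    rcases List.mem_cons.1 h' with rfl | h'
    · exact ht.1
    · exact ih t h'

/-- The number of tokens that a sequence removes from `p`. -/
noncomputable def removals (N : Net α) (p : α) (σ : List α) : ℕ :=
  σ.countP fun t => decide (N.F p t)

/-- The number of tokens that a sequence adds to `p`. -/
noncomputable def insertions (N : Net α) (p : α) (σ : List α) : ℕ :=
  σ.countP fun t => decide (N.F t p)

theorem removals_pos {p : α} {σ : List α} : 0 < N.removals p σ ↔ ∃ t ∈ σ, N.F p t := by
  simp [removals, List.countP_pos_iff]

theorem insertions_pos {p : α} {σ : List α} : 0 < N.insertions p σ ↔ ∃ t ∈ σ, N.F t p := by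
  simp [insertions, List.countP_pos_iff]

/-- The marking equation. -/
theorem FireSeq.marking_eq {σ : List α} (h : N.FireSeq μ σ ν) (p : α) :
    ν p + N.removals p σ = μ p + N.insertions p σ := by
  induction h with
  | nil => simp [removals, insertions]
  | @cons μ ν t σ ht _ ih =>
    have h1 := ht.2 p
    simp only [removals, insertions, List.countP_cons, fire, decide_eq_true_eq] at ih ⊢
    split_ifs at ih ⊢ with h2 h3 <;> first | omega | (have := h1 h2; omega)

/-- Every enabled step of a free-choice net can be replaced by the first transition of the same
cluster occurring in a given occurrence sequence. -/
theorem FreeChoice.expedite (hfc : N.FreeChoice) {p t : α} {σ : List α} (hp : p ∈ N.places)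
    (hpt : N.F p t) (ht : N.Enabled μ t) (hσ : N.FireSeq μ σ ν) (hex : ∃ v ∈ σ, N.F p v) :
    ∃ v τ, N.F p v ∧ N.FireSeq (N.fire v μ) τ ν ∧ τ.length < σ.length := by
  induction hσ with
  | nil => simp at hex
  | @cons μ ν a σ ha hσ ih =>
    by_cases hpa : N.F p a
    · exact ⟨a, σ, hpa, hσ, by simp⟩
    have hne : ∀ q, N.F q t → ¬ N.F q a := fun q hqt hqa =>
      hpa (hfc.post_subset (place_of_edge_transition hqt ht.1) hqt hpt hqa)
    have ht' : N.Enabled (N.fire a μ) t := by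
      refine ⟨ht.1, fun q hq => ?_⟩
      have h1 := ht.2 q hq
      simp only [fire, if_neg (hne q hq)]
      omega
    obtain ⟨v, τ, hpv, hτ, hlen⟩ := ih ht' (by
      obtain ⟨v, hv, hpv⟩ := hex
      rcases List.mem_cons.1 hv with rfl | hv
      · exact absurd hpv hpa
      · exact ⟨v, hv, hpv⟩)
    have hvt : ∀ q, N.F q v → N.F q t := fun q hq => hfc.post_subset hp hpv hq hpt
    refine ⟨v, a :: τ, hpv, .cons ⟨ha.1, fun q hq => ?_⟩ ?_, by simpa using hlen⟩
    · have h1 := ha.2 q hq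
      have h2 : ¬ N.F q v := fun h => hne q (hvt q h) hq
      simp only [fire, if_neg h2]
      omega
    · convert hτ using 1
      funext q
      have h1 := ha.2 q
      have h2 := fun h => ht.2 q (hvt q h)
      have h3 := fun h => hne q (hvt q h)
      simp only [fire]
      split_ifs <;> simp_all

/-! ### Live and bounded nets -/

theorem Live.exists_enabled (hl : N.Live μ₀) (hT : N.transitions.Nonempty)
    (h : N.Reach μ₀ μ) : ∃ t, N.Enabled μ t := by
  obtain ⟨t, ht⟩ := hT
  obtain ⟨ν, ⟨σ, hσ⟩, hν⟩ := hl t ht μ h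
  cases hσ with
  | nil => exact ⟨t, hν⟩
  | cons ha _ => exact ⟨_, ha⟩

theorem Bounded.no_post_of_no_pre (hb : N.Bounded μ₀) {t p : α} (ht : t ∈ N.transitions)
    (hpre : ∀ q, ¬ N.F q t) : ¬ N.F t p := by
  intro htp
  obtain ⟨K, hK⟩ := hb
  have hfire : ∀ n, ∃ ν, N.FireSeq μ₀ (List.replicate n t) ν := by
    intro n
    induction n with
    | zero => exact ⟨_, .nil _⟩
    | succ n ih =>
      obtain ⟨ν, hν⟩ := ih
      refine ⟨N.fire t ν, ?_⟩
      rw [List.replicate_succ']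
      exact hν.append (.single ⟨ht, fun q hq => absurd hq (hpre q)⟩)
  obtain ⟨ν, hν⟩ := hfire (K + 1)
  have h1 := hν.marking_eq p
  have h2 := hK ν ⟨_, hν⟩ p (place_of_transition_edge htp ht)
  simp [removals, insertions, List.countP_replicate, htp, hpre] at h1
  omega

/-- A transition without outputs may be left out of an occurrence sequence. -/
theorem FireSeq.filter_of_no_post {σ : List α} {t : α} (h : N.FireSeq μ σ ν)
    (hpost : ∀ q, ¬ N.F t q) {μ' : α → ℕ} (hle : ∀ q, μ q ≤ μ' q) :
    ∃ ν', N.FireSeq μ' (σ.filter (· ≠ t)) ν' := by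
  induction h generalizing μ' with
  | nil => exact ⟨_, .nil _⟩
  | @cons μ ν a σ ha _ ih =>
    by_cases hat : a = t
    · subst hat
      simp only [ne_eq, decide_not, decide_true, Bool.not_true, Bool.false_eq_true,
        not_false_eq_true, List.filter_cons_of_neg]
      simp only [ne_eq, decide_not] at ih
      refine ih fun q => ?_
      have := hle q
      simp only [fire, if_neg (hpost q)]
      omega
    · have hle' : ∀ q, N.fire a μ q ≤ N.fire a μ' q := by
        intro q
        have := hle q
        simp only [fire]
        omega
      obtain ⟨ν', hν'⟩ := ih hle'
      refine ⟨ν', ?_⟩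
      rw [List.filter_cons_of_pos (by simpa using hat)]
      exact .cons ⟨ha.1, fun q hq => (ha.2 q hq).trans (hle q)⟩ hν'

theorem Bounded.no_pre_of_no_post (hb : N.Bounded μ₀) (hl : N.Live μ₀) {t p : α}
    (ht : t ∈ N.transitions) (hpost : ∀ q, ¬ N.F t q) : ¬ N.F p t := by
  intro hpt
  obtain ⟨K, hK⟩ := hb
  have hfire : ∀ n, ∃ σ ν, N.FireSeq μ₀ σ ν ∧ n ≤ σ.count t := by
    intro n
    induction n with
    | zero => exact ⟨_, _, .nil _, Nat.zero_le _⟩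
    | succ n ih =>
      obtain ⟨σ, ν, hσ, hn⟩ := ih
      obtain ⟨ξ, ⟨τ, hτ⟩, hξ⟩ := hl t ht ν ⟨_, hσ⟩
      refine ⟨_, _, (hσ.append hτ).append (.single hξ), ?_⟩
      simp only [List.count_append, List.count_singleton_self]
      omega
  obtain ⟨σ, ν, hσ, hn⟩ := hfire (K + 1)
  obtain ⟨ν', hν'⟩ := hσ.filter_of_no_post hpost fun q => le_rfl
  have h1 := hσ.marking_eq p
  have h2 := hν'.marking_eq p
  have h3 := hK ν' ⟨_, hν'⟩ p (place_of_edge_transition hpt ht)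
  have h4 : N.insertions p (σ.filter (· ≠ t)) = N.insertions p σ := by
    simp only [insertions, List.countP_filter]
    refine List.countP_congr fun a _ => ?_
    have : N.F a p → a ≠ t := fun h h' => hpost p (h' ▸ h)
    simpa using this
  have h5 : N.removals p σ = N.removals p (σ.filter (· ≠ t)) + σ.count t := by
    clear h1 h2 h4 hν' hσ hn
    induction σ with
    | nil => simp [removals]
    | cons a σ ih =>
      by_cases hat : a = t
      · subst hat
        simp_all [removals]
        omega
      · simp_all [removals, List.countP_cons]
        omega
  omega

/-! ### Clusters -/

theorem FreeChoice.clusterClosed_pre_union_post (hfc : N.FreeChoice) {p t : α}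
    (hp : p ∈ N.places) (hpt : N.F p t) : N.ClusterClosed (N.pre t ∪ N.post p) := by
  have ht := transition_of_place_edge hpt hp
  constructor
  · rintro q (hq | hq) hqP u hu
    · exact Or.inr (hfc.post_subset hqP hq hpt hu)
    · exact absurd hqP (Finset.disjoint_right.1 N.disj (transition_of_place_edge hq hp))
  · rintro u (hu | hu) huT q hq
    · exact absurd huT (Finset.disjoint_left.1 N.disj (place_of_edge_transition hu ht))
    · exact Or.inl (hfc.post_subset hp hu hq hpt)

theorem FreeChoice.clusterClosed_compl_pre_union_post (hfc : N.FreeChoice) {p t : α}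
    (hp : p ∈ N.places) (hpt : N.F p t) : N.ClusterClosed (N.pre t ∪ N.post p)ᶜ := by
  have ht := transition_of_place_edge hpt hp
  constructor
  · rintro q hq hqP u hu (h | h)
    · exact absurd (transition_of_place_edge hu hqP)
        (Finset.disjoint_left.1 N.disj (place_of_edge_transition h ht))
    · exact hq (Or.inl (hfc.post_subset hp h hu hpt))
  · rintro u hu huT q hq (h | h)
    · exact hu (Or.inr (hfc.post_subset (place_of_edge_transition hq huT) h hpt hq))
    · exact absurd (place_of_edge_transition hq huT)
        (Finset.disjoint_right.1 N.disj (transition_of_place_edge h hp))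

theorem FreeChoice.cluster_subset [DecidableEq α] (hfc : N.FreeChoice) (hcl : N.IsCluster cl)
    {p t : α} (hp : p ∈ N.places) (hpt : N.F p t) (hpc : p ∈ cl) : cl ⊆ N.pre t ∪ N.post p := by
  obtain ⟨x, -, rfl⟩ := hcl
  by_cases hx : x ∈ N.pre t ∪ N.post p
  · exact Set.sInter_subset_of_mem ⟨hx, hfc.clusterClosed_pre_union_post hp hpt⟩
  · exact absurd (Or.inl hpt)
      (Set.mem_sInter.1 hpc _ ⟨hx, hfc.clusterClosed_compl_pre_union_post hp hpt⟩)

theorem IsCluster.closed [DecidableEq α] (hcl : N.IsCluster cl) : N.ClusterClosed cl := by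
  obtain ⟨x, -, rfl⟩ := hcl
  constructor
  · intro p hp hpP t ht S' hS'
    exact hS'.2.1 p (hp S' hS') hpP t ht
  · intro t ht htT p hp S' hS'
    exact hS'.2.2 t (ht S' hS') htT p hp

theorem IsCluster.subset_nodes [DecidableEq α] (hcl : N.IsCluster cl) :
    cl ⊆ (N.nodes : Set α) := by
  obtain ⟨x, hx, rfl⟩ := hcl
  refine Set.sInter_subset_of_mem ⟨hx, fun p _ hp t ht => ?_, fun t _ ht p hp => ?_⟩
  · exact Finset.mem_union_right _ (transition_of_place_edge ht hp)
  · exact Finset.mem_union_left _ (place_of_edge_transition hp ht)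

theorem FreeChoice.edge_of_mem_cluster [DecidableEq α] (hfc : N.FreeChoice) (hcl : N.IsCluster cl)
    {p q t : α} (hp : p ∈ N.places) (hpt : N.F p t) (hpc : p ∈ cl) (hq : q ∈ N.places) (hqc : q ∈ cl) :
    N.F q t := by
  rcases hfc.cluster_subset hcl hp hpt hpc hqc with h | h
  · exact h
  · exact absurd hq (Finset.disjoint_right.1 N.disj (transition_of_place_edge h hp))

theorem IsCluster.mem_of_edge [DecidableEq α] (hcl : N.IsCluster cl)
    {p q t : α} (hp : p ∈ N.places) (hpt : N.F p t) (hpc : p ∈ cl) (hqt : N.F q t) : q ∈ cl :=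
  hcl.closed.2 t (hcl.closed.1 p hpc hp t hpt) (transition_of_place_edge hpt hp) q hqt

/-! ### Markings covering the regeneration marking -/

/-- A reachable marking covered by a marking from which the regeneration marking is reachable
coincides with it. -/
theorem eq_of_le_of_fireSeq_clusterMarking [DecidableEq α] (hfc : N.FreeChoice) (hl : N.Live μ₀)
    (hcl : N.IsCluster cl) (hT : N.transitions.Nonempty)
    (hpre : ∀ t ∈ N.transitions, ∃ p, N.F p t) (hpost : ∀ t ∈ N.transitions, ∃ p, N.F t p)
    {m M M' : α → ℕ} {σ : List α} (hm : N.Reach μ₀ m) (hle : ∀ p ∈ N.places, m p ≤ M p)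
    (hσ : N.FireSeq M σ M') (hM' : N.MarkingEq M' (N.clusterMarking cl)) :
    N.MarkingEq M m := by
  induction hn : σ.length using Nat.strong_induction_on generalizing σ m M with
  | _ n ih =>
  obtain ⟨t, ht⟩ := hl.exists_enabled hT hm
  obtain ⟨p, hpt⟩ := hpre t ht.1
  have hp := place_of_edge_transition hpt ht.1
  have htM : N.Enabled M t :=
    ⟨ht.1, fun q hq => (ht.2 q hq).trans (hle q (place_of_edge_transition hq ht.1))⟩
  by_cases hex : ∃ v ∈ σ, N.F p v
  · obtain ⟨v, τ, hpv, hτ, hlen⟩ := hfc.expedite hp hpt htM hσ hex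
    have hv : N.Enabled m v := ⟨transition_of_place_edge hpv hp,
      fun q hq => ht.2 q (hfc.post_subset hp hpv hq hpt)⟩
    have key := ih τ.length (hn ▸ hlen) (hm.fire hv) (fun q hq => by
      have := hle q hq
      simp only [fire]
      omega) hτ rfl
    intro q hq
    have h1 := key q hq
    have h2 := hv.2 q
    have h3 := hle q hq
    simp only [fire] at h1
    split_ifs at h1 with h4 <;> first | omega | (have := h2 h4; omega)
  · have hkeep : ∀ q ∈ N.places, q ∈ N.pre t → N.removals q σ = 0 := by
      intro q hq hqt
      by_contra h
      obtain ⟨v, hv, hqv⟩ := removals_pos.1 (Nat.pos_of_ne_zero h)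
      exact hex ⟨v, hv, hfc.post_subset hq hqt hpt hqv⟩
    have hpc : p ∈ cl := by
      by_contra h
      have h1 := hσ.marking_eq p
      have h2 := hM' p hp
      have h3 := htM.2 p hpt
      have h4 := hkeep p hp hpt
      simp only [clusterMarking, h, false_and, if_false] at h2
      omega
    rcases List.eq_nil_or_concat σ with rfl | ⟨τ, v, rfl⟩
    · cases hσ
      intro q hq
      have h1 := hM' q hq
      have h2 := hle q hq
      by_cases hqc : q ∈ cl
      · have h3 := ht.2 q (hfc.edge_of_mem_cluster hcl hp hpt hpc hq hqc)
        simp only [clusterMarking, hqc, hq, and_self, if_true] at h1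
        omega
      · simp only [clusterMarking, hqc, false_and, if_false] at h1
        omega
    · exfalso
      have hvσ : v ∈ τ.concat v := by simp
      have hvT := hσ.mem_transitions v hvσ
      obtain ⟨q, hvq⟩ := hpost v hvT
      have hq := place_of_transition_edge hvq hvT
      obtain ⟨ξ, -, hξ⟩ := (List.concat_eq_append ▸ hσ).of_append
      have hM'q : 1 ≤ M' q := by
        cases hξ with
        | cons _ h =>
          cases h
          simp only [fire, if_pos hvq]
          omega
      have h1 := hM' q hq
      have hqc : q ∈ cl := by
        by_contra h
        simp only [clusterMarking, h, false_and, if_false] at h1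
        omega
      simp only [clusterMarking, hqc, hq, and_self, if_true] at h1
      have hqt := hfc.edge_of_mem_cluster hcl hp hpt hpc hq hqc
      have h2 := hσ.marking_eq q
      have h3 := hkeep q hq hqt
      have h4 := htM.2 q hqt
      have h5 : 0 < N.insertions q (τ.concat v) := insertions_pos.2 ⟨v, hvσ, hvq⟩
      omega

/-! ### Allocations directed towards the regeneration cluster -/

/-- `Leads N V K n p`: some path with `n` transitions, all of them in `V`, leads from the place
`p` to a place in `K`. -/
def Leads (N : Net α) (V K : Set α) : ℕ → α → Prop
  | 0, p => p ∈ K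
  | n + 1, p => ∃ t ∈ V, N.F p t ∧ ∃ q, N.F t q ∧ Leads N V K n q

/-- `A` selects one output transition for every place outside `cl`, the same one for all places of
a cluster, such that following the selection decreases the distance `δ`. -/
structure IsAllocation (N : Net α) (V cl : Set α) (A : α → α) (δ : α → ℕ) : Prop where
  edge : ∀ p ∈ N.places, p ∉ cl → N.F p (A p)
  mem : ∀ p ∈ N.places, p ∉ cl → A p ∈ V
  descends : ∀ p ∈ N.places, p ∉ cl → ∃ q, N.F (A p) q ∧ δ q < δ p
  congr : ∀ p p', p ∉ cl → p' ∉ cl → N.post p = N.post p' → A p = A p'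

theorem exists_isAllocation {V : Set α} (h : ∀ p ∈ N.places, ∃ n, N.Leads V cl n p) :
    ∃ A δ, N.IsAllocation V cl A δ := by
  let δ : α → ℕ := fun p => sInf {n | N.Leads V cl n p}
  have hδ : ∀ p p', p ∉ cl → p' ∉ cl → N.post p = N.post p' → δ p = δ p' := by
    intro p p' hp hp' hpp
    have : ∀ n, N.Leads V cl n p ↔ N.Leads V cl n p' := by
      intro n
      cases n with
      | zero => simp [Leads, hp, hp']
      | succ n =>
        have : ∀ t, N.F p t ↔ N.F p' t := fun t => Set.ext_iff.1 hpp t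
        simp only [Leads, this]
    simp only [δ, this]
  let Q : Set α → ℕ → α → Prop := fun X d t => t ∈ X ∧ t ∈ V ∧ ∃ q, N.F t q ∧ δ q < d
  have hQ : ∀ p ∈ N.places, p ∉ cl → ∃ t, Q (N.post p) (δ p) t := by
    intro p hp hpc
    have h1 : N.Leads V cl (δ p) p := Nat.sInf_mem (h p hp)
    cases hn : δ p with
    | zero =>
      rw [hn] at h1
      exact absurd h1 hpc
    | succ n =>
      rw [hn] at h1
      obtain ⟨t, htV, hpt, q, htq, hq⟩ := h1
      exact ⟨t, hpt, htV, q, htq, Nat.lt_succ_of_le (Nat.sInf_le hq)⟩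
  let g : Set α → ℕ → α → α := fun X d a => if h : ∃ t, Q X d t then h.choose else a
  have hne : ∀ p ∈ N.places, p ∉ cl → ∀ a, Q (N.post p) (δ p) (g (N.post p) (δ p) a) := by
    intro p hp hpc a
    simp only [g, dif_pos (hQ p hp hpc)]
    exact (hQ p hp hpc).choose_spec
  by_cases hα : Nonempty α
  · obtain ⟨a⟩ := hα
    refine ⟨fun p => g (N.post p) (δ p) a, δ, fun p hp hpc => (hne p hp hpc a).1,
      fun p hp hpc => (hne p hp hpc a).2.1, fun p hp hpc => (hne p hp hpc a).2.2, ?_⟩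
    intro p p' hp hp' hpp
    simp only [hpp, hδ p p' hp hp' hpp]
  · rw [not_nonempty_iff] at hα
    exact ⟨id, δ, by simp, by simp, by simp, by simp⟩

/-- All transitions of the sequence are selected by the allocation `A` outside `cl`. -/
def Follows (N : Net α) (cl : Set α) (A : α → α) (σ : List α) : Prop :=
  ∀ t ∈ σ, ∀ p, N.F p t → p ∉ cl ∧ t = A p

theorem Follows.removals_eq_zero {A : α → α} {σ : List α} (h : N.Follows cl A σ) {p : α}
    (hp : p ∈ cl) : N.removals p σ = 0 := by
  by_contra hne
  obtain ⟨t, ht, hpt⟩ := removals_pos.1 (Nat.pos_of_ne_zero hne)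
  exact (h t ht p hpt).1 hp

theorem Follows.removals_le_insertions {A : α → α} {σ : List α} (h : N.Follows cl A σ) {p q : α}
    (hq : N.F (A p) q) : N.removals p σ ≤ N.insertions q σ := by
  refine List.countP_mono_left fun t ht hpt => ?_
  simp only [decide_eq_true_eq] at hpt ⊢
  rw [(h t ht p hpt).2]
  exact hq

theorem Follows.removals_le {V : Set α} {A : α → α} {δ : α → ℕ} {σ : List α}
    (hA : N.IsAllocation V cl A δ) (h : N.Follows cl A σ) (hσ : N.FireSeq μ σ ν) {K : ℕ}
    (hK : ∀ p ∈ N.places, ν p ≤ K) {p : α} (hp : p ∈ N.places) :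
    N.removals p σ ≤ K * δ p := by
  induction hd : δ p using Nat.strong_induction_on generalizing p with
  | _ d ih =>
  by_cases hpc : p ∈ cl
  · simp [h.removals_eq_zero hpc]
  obtain ⟨q, hq, hlt⟩ := hA.descends p hp hpc
  have hqP := place_of_transition_edge hq (transition_of_place_edge (hA.edge p hp hpc) hp)
  have h1 := h.removals_le_insertions hq
  have h2 := hσ.marking_eq q
  have h3 := hK q hqP
  have h4 := ih (δ q) (hd ▸ hlt) hqP rfl
  have h5 : K * (δ q + 1) ≤ K * d := Nat.mul_le_mul_left K (hd ▸ hlt)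
  rw [Nat.mul_add, Nat.mul_one] at h5
  omega

theorem Follows.removals_le_one [DecidableEq α] {V : Set α} {A : α → α} {δ : α → ℕ} {σ : List α}
    (hA : N.IsAllocation V cl A δ) (h : N.Follows cl A σ) (hσ : N.FireSeq μ σ ν)
    (hν : N.MarkingEq ν (N.clusterMarking cl)) {p : α} (hp : p ∈ N.places) :
    ν p + N.removals p σ ≤ 1 := by
  induction hd : δ p using Nat.strong_induction_on generalizing p with
  | _ d ih =>
  have h0 := hν p hp
  by_cases hpc : p ∈ cl
  · simp only [clusterMarking, hpc, hp, and_self, if_true] at h0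
    simp [h.removals_eq_zero hpc, h0]
  simp only [clusterMarking, hpc, false_and, if_false] at h0
  obtain ⟨q, hq, hlt⟩ := hA.descends p hp hpc
  have hqP := place_of_transition_edge hq (transition_of_place_edge (hA.edge p hp hpc) hp)
  have h1 := h.removals_le_insertions hq
  have h2 := hσ.marking_eq q
  have h4 := ih (δ q) (hd ▸ hlt) hqP rfl
  omega

theorem length_le_sum_removals {σ : List α} (hpre : ∀ t ∈ σ, ∃ p ∈ N.places, N.F p t) :
    σ.length ≤ ∑ p ∈ N.places, N.removals p σ := by
  induction σ with
  | nil => simp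
  | cons t σ ih =>
    have h1 := ih fun u hu => hpre u (List.mem_cons_of_mem _ hu)
    obtain ⟨p, hp, hpt⟩ := hpre t (by simp)
    have h2 : 1 ≤ ∑ q ∈ N.places, if N.F q t then 1 else 0 := by
      refine le_trans ?_ (Finset.single_le_sum (fun _ _ => Nat.zero_le _) hp)
      simp [hpt]
    simp only [removals, List.countP_cons, Finset.sum_add_distrib, List.length_cons,
      decide_eq_true_eq] at h1 ⊢
    omega

/-- Following an allocation directed towards the regeneration cluster leads from every reachable
marking to the regeneration marking. -/
theorem exists_follows_fireSeq [DecidableEq α] (hfc : N.FreeChoice) (hperp : N.Perpetual μ₀ cl)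
    (hT : N.transitions.Nonempty)
    (hpre : ∀ t ∈ N.transitions, ∃ p, N.F p t) (hpost : ∀ t ∈ N.transitions, ∃ p, N.F t p)
    {V : Set α} {A : α → α} {δ : α → ℕ} (hA : N.IsAllocation V cl A δ) (hμ : N.Reach μ₀ μ) :
    ∃ σ ν, N.FireSeq μ σ ν ∧ N.Follows cl A σ ∧ N.MarkingEq ν (N.clusterMarking cl) := by
  obtain ⟨hl, ⟨K, hK⟩, hcl, hhome⟩ := hperp
  let L : Set ℕ := {n | ∃ σ ν, N.FireSeq μ σ ν ∧ N.Follows cl A σ ∧ σ.length = n}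
  have hLne : L.Nonempty := ⟨0, [], μ, .nil μ, by simp [Follows], rfl⟩
  have hLb : BddAbove L := by
    refine ⟨∑ p ∈ N.places, K * δ p, ?_⟩
    rintro _ ⟨σ, ν, hσ, hf, rfl⟩
    refine (length_le_sum_removals fun t ht => ?_).trans
      (Finset.sum_le_sum fun p hp => hf.removals_le hA hσ (hK ν (hμ.trans ⟨_, hσ⟩)) hp)
    have htT := hσ.mem_transitions t ht
    obtain ⟨p, hpt⟩ := hpre t htT
    exact ⟨p, place_of_edge_transition hpt htT, hpt⟩
  obtain ⟨σ, ν, hσ, hf, hlen⟩ := Nat.sSup_mem hLne hLb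
  have hν : N.Reach μ₀ ν := hμ.trans ⟨_, hσ⟩
  obtain ⟨t, ht⟩ := hl.exists_enabled hT hν
  obtain ⟨p, hpt⟩ := hpre t ht.1
  have hp := place_of_edge_transition hpt ht.1
  have hpc : p ∈ cl := by
    by_contra hpc
    have hpA := hA.edge p hp hpc
    have hAT := transition_of_place_edge hpA hp
    have hen : N.Enabled ν (A p) :=
      ⟨hAT, fun q hq => ht.2 q (hfc.post_subset hp hpA hq hpt)⟩
    have hmem : (σ ++ [A p]).length ∈ L := by
      refine ⟨_, _, hσ.append (.single hen), fun u hu q hq => ?_, rfl⟩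
      rcases List.mem_append.1 hu with hu | hu
      · exact hf u hu q hq
      · obtain rfl := List.mem_singleton.1 hu
        have hqP := place_of_edge_transition hq hAT
        have hqc : q ∉ cl := fun h => hpc (hcl.mem_of_edge hqP hq h hpA)
        refine ⟨hqc, hA.congr p q hpc hqc (Set.ext fun v => ⟨fun hv => ?_, fun hv => ?_⟩)⟩
        · exact hfc.post_subset hp hpA hq hv
        · exact hfc.post_subset hqP hq hpA hv
    have := le_csSup hLb hmem
    simp only [List.length_append, List.length_singleton] at this
    omega
  obtain ⟨ξ, ⟨τ, hτ⟩, hξ⟩ := hhome ν hν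
  have hle : ∀ q ∈ N.places, ξ q ≤ ν q := by
    intro q hq
    rw [hξ q hq]
    by_cases hqc : q ∈ cl
    · have := ht.2 q (hfc.edge_of_mem_cluster hcl hp hpt hpc hq hqc)
      simpa [clusterMarking, hqc, hq] using this
    · simp [clusterMarking, hqc]
  refine ⟨σ, ν, hσ, hf, fun q hq => ?_⟩
  rw [eq_of_le_of_fireSeq_clusterMarking hfc hl hcl hT hpre hpost (hν.trans ⟨_, hτ⟩) hle hτ hξ q hq,
    hξ q hq]

/-! ### CP-subnets -/

/-- A way-in transition of a CP-subnet of a free-choice net has no input place in the subnet. -/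
theorem IsCPSubnet.pre_subset [DecidableEq α] (hfc : N.FreeChoice) (hS : N.IsCPSubnet S)
    {p q t : α} (ht : t ∈ N.transitions) (hqt : N.F q t) (hq : q ∈ S) (hpt : N.F p t) : p ∈ S := by
  by_contra hp
  obtain ⟨-, -, -, hbord, -, ⟨v, hv⟩, hsc⟩ := hS
  obtain ⟨hvS, hvT⟩ := Finset.mem_inter.1 hv
  have hpP := place_of_edge_transition hpt ht
  have hqP := place_of_edge_transition hqt ht
  have hpS : p ∈ N.nodes \ S := Finset.mem_sdiff.2 ⟨Finset.mem_union_left _ hpP, hp⟩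
  rcases Relation.ReflTransGen.cases_head (hsc p hpS v hvS) with rfl | ⟨u, ⟨-, hu, hpu⟩, -⟩
  · exact Finset.disjoint_left.1 N.disj hpP hvT
  · exact (Finset.mem_sdiff.1 hu).2
      (hbord q hq hqP u (Or.inr (hfc.post_subset hpP hpt hqt hpu)))

theorem marked_trap {Z : Set α} {σ : List α} (h : N.FireSeq μ σ ν)
    (hZ : ∀ p ∈ Z, ∀ t ∈ N.transitions, N.F p t → ∃ q ∈ Z, N.F t q)
    (hμ : ∃ p ∈ Z, 1 ≤ μ p) : ∃ p ∈ Z, 1 ≤ ν p := by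
  induction h with
  | nil => exact hμ
  | @cons μ ν t σ ht _ ih =>
    refine ih ?_
    obtain ⟨p, hpZ, hp⟩ := hμ
    by_cases hpt : N.F p t
    · obtain ⟨q, hqZ, hq⟩ := hZ p hpZ t ht.1 hpt
      exact ⟨q, hqZ, by simp [fire, hq]⟩
    · exact ⟨p, hpZ, by simp only [fire, if_neg hpt]; omega⟩

/-- If the regeneration marking is empty, no transition has an output place. -/
theorem Perpetual.no_post_of_cluster_no_place [DecidableEq α] (hperp : N.Perpetual μ₀ cl)
    (hempty : ∀ p ∈ N.places, p ∉ cl) {t p : α} (ht : t ∈ N.transitions) : ¬ N.F t p := by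
  obtain ⟨hl, hb, hcl, hhome⟩ := hperp
  have hzero : ∀ {σ : List α} {μ ν : α → ℕ}, N.FireSeq μ σ ν → (∀ q ∈ N.places, μ q = 0) →
      ∀ q ∈ N.places, ν q = 0 := by
    intro σ μ ν h
    induction h with
    | nil => exact id
    | @cons μ ν u σ hu _ ih =>
      intro hμ
      refine ih fun q hq => ?_
      have hpre : ∀ r, ¬ N.F r u := fun r hr => by
        have := hu.2 r hr
        rw [hμ r (place_of_edge_transition hr hu.1)] at this
        omega
      simp [fire, hμ q hq, hpre, hb.no_post_of_no_pre hu.1 hpre]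
  obtain ⟨ν, hν, hν0⟩ := hhome μ₀ ⟨[], .nil _⟩
  obtain ⟨ξ, ⟨σ, hσ⟩, hξ⟩ := hl t ht ν hν
  have h0 := hzero hσ fun q hq => by rw [hν0 q hq]; simp [clusterMarking, hempty q hq]
  refine hb.no_post_of_no_pre ht fun r hr => ?_
  have := hξ.2 r hr
  rw [h0 r (place_of_edge_transition hr ht)] at this
  omega

/-- If an adapted CP-subnet has a place, then the net has no isolated transition. -/
theorem IsCPSubnet.not_isolated [DecidableEq α] (hS : N.IsCPSubnet S) (hperp : N.Perpetual μ₀ cl)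
    (had : ¬ cl ⊆ (S : Set α)) {p t : α} (hpS : p ∈ S) (hp : p ∈ N.places)
    (ht : t ∈ N.transitions) (hpre : ∀ q, ¬ N.F q t) (hpost : ∀ q, ¬ N.F t q) : False := by
  obtain ⟨-, -, hwc, -, htn, -, hsc⟩ := hS
  have hne : t ≠ p := fun h => Finset.disjoint_left.1 N.disj hp (h ▸ ht)
  by_cases htS : t ∈ S
  · rcases Relation.ReflTransGen.cases_head (hwc t htS p hpS) with h | ⟨u, ⟨-, -, h | h⟩, -⟩
    · exact hne h
    · exact hpost u h
    · exact hpre u h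
  have honly : ∀ y ∈ N.nodes, y ∉ S → y = t := by
    intro y hy hyS
    have htn : t ∈ N.nodes \ S := Finset.mem_sdiff.2 ⟨Finset.mem_union_right _ ht, htS⟩
    rcases Relation.ReflTransGen.cases_head
      (hsc t htn y (Finset.mem_sdiff.2 ⟨hy, hyS⟩)) with h | ⟨u, ⟨-, -, h⟩, -⟩
    · exact h.symm
    · exact absurd h (hpost u)
  obtain ⟨y, hycl, hyS⟩ := Set.not_subset.1 had
  obtain rfl := honly y (hperp.2.2.1.subset_nodes hycl) hyS
  have hcl1 : ∀ q ∈ N.places, q ∉ cl := by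
    obtain ⟨x, -, rfl⟩ := hperp.2.2.1
    have hx : x = y := by
      by_contra hx
      refine Set.mem_sInter.1 hycl {y}ᶜ ⟨hx, ?_, ?_⟩ rfl
      · rintro q - - u hu rfl
        exact hpre q hu
      · rintro u - - q hq rfl
        exact hpost u hq
    subst hx
    intro q hq hqc
    have : q ∈ ({x} : Set α) := by
      refine Set.mem_sInter.1 hqc {x} ⟨rfl, ?_, ?_⟩
      · rintro r rfl - u hu
        exact absurd hu (hpost u)
      · rintro u rfl - r hr
        exact absurd hr (hpre r)
    exact Finset.disjoint_left.1 N.disj hq (Set.mem_singleton_iff.1 this ▸ ht)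
  obtain ⟨u, hu, -⟩ := (htn p hpS hp).1
  exact hperp.no_post_of_cluster_no_place hcl1 (transition_of_edge_place hu.2 hp) hu.2

theorem IsCPSubnet.cluster_place_not_mem [DecidableEq α] (hfc : N.FreeChoice) (hS : N.IsCPSubnet S)
    (hcl : N.IsCluster cl) (had : ¬ cl ⊆ (S : Set α)) {p : α} (hp : p ∈ N.places)
    (hpc : p ∈ cl) : p ∉ S := by
  intro hpS
  obtain ⟨t, ⟨htS, hpt⟩, -⟩ := (hS.2.2.2.2.1 p hpS hp).2
  refine had ((hfc.cluster_subset hcl hp hpt hpc).trans ?_)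
  rintro q (hq | hq)
  · exact hS.pre_subset hfc (transition_of_place_edge hpt hp) hpt hpS hq
  · exact hS.2.2.2.1 p hpS hp q (Or.inr hq)

/-- From every place the regeneration cluster can be reached without using way-in transitions of
an adapted CP-subnet. -/
theorem IsCPSubnet.exists_leads [DecidableEq α] (hfc : N.FreeChoice) (hS : N.IsCPSubnet S)
    (hperp : N.Perpetual μ₀ cl) (had : ¬ cl ⊆ (S : Set α))
    (hpre : ∀ t ∈ N.transitions, ∃ p, N.F p t) (hpost : ∀ t ∈ N.transitions, ∃ p, N.F t p)
    {p : α} (hp : p ∈ N.places) : ∃ n, N.Leads {t | ¬ N.IsWayIn S t} cl n p := by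
  obtain ⟨hl, -, hcl, hhome⟩ := hperp
  obtain ⟨k, hk, hkc⟩ : ∃ k ∈ N.places, k ∈ cl := by
    obtain ⟨y, hy, -⟩ := Set.not_subset.1 had
    rcases Finset.mem_union.1 (hcl.subset_nodes hy) with h | h
    · exact ⟨y, h, hy⟩
    · obtain ⟨q, hq⟩ := hpre y h
      exact ⟨q, place_of_edge_transition hq h, hcl.closed.2 y hy h q hq⟩
  have hkS : k ∈ N.nodes \ S := Finset.mem_sdiff.2
    ⟨Finset.mem_union_left _ hk, hS.cluster_place_not_mem hfc hcl had hk hkc⟩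
  have hout : ∀ q ∈ N.places, q ∉ S → ∃ n, N.Leads {t | ¬ N.IsWayIn S t} cl n q := by
    intro q hq hqS
    have hpath := hS.2.2.2.2.2.2 q (Finset.mem_sdiff.2 ⟨Finset.mem_union_left _ hq, hqS⟩) k hkS
    have key : (q ∈ N.places → ∃ n, N.Leads {t | ¬ N.IsWayIn S t} cl n q) ∧
        (q ∈ N.transitions → ∃ r, N.F q r ∧ ∃ n, N.Leads {t | ¬ N.IsWayIn S t} cl n r) := by
      clear hq hqS
      induction hpath using Relation.ReflTransGen.head_induction_on with
      | refl => exact ⟨fun _ => ⟨0, hkc⟩, fun h => absurd h (Finset.disjoint_left.1 N.disj hk)⟩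
      | @head a b hab _ ih =>
        obtain ⟨-, hb, hF⟩ := hab
        refine ⟨fun ha => ?_, fun ha => ⟨b, hF, ih.1 (place_of_transition_edge hF ha)⟩⟩
        obtain ⟨r, hr, n, hn⟩ := ih.2 (transition_of_place_edge hF ha)
        exact ⟨n + 1, b, fun h => (Finset.mem_sdiff.1 hb).2 h.1, hF, r, hr, hn⟩
    exact key.1 hq
  by_contra hcon
  let Z : Set α := {q | q ∈ S ∧ q ∈ N.places ∧ ¬ ∃ n, N.Leads {t | ¬ N.IsWayIn S t} cl n q}
  have hpS : p ∈ S := by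
    by_contra h
    exact hcon (hout p hp h)
  have hZ : ∀ q ∈ Z, ∀ t ∈ N.transitions, N.F q t → ∃ r ∈ Z, N.F t r := by
    rintro q ⟨hqS, hq, hn⟩ t ht hqt
    obtain ⟨r, hr⟩ := hpost t ht
    have hrP := place_of_transition_edge hr ht
    have hr' : ¬ ∃ n, N.Leads {t | ¬ N.IsWayIn S t} cl n r := by
      rintro ⟨n, hn'⟩
      refine hn ⟨n + 1, t, ?_, hqt, r, hr, hn'⟩
      rintro ⟨-, -, s, -, hsS, hst⟩
      exact hsS (hS.pre_subset hfc ht hqt hqS hst)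
    refine ⟨r, ⟨?_, hrP, hr'⟩, hr⟩
    by_contra h
    exact hr' (hout r hrP h)
  obtain ⟨u, ⟨-, hup⟩, -⟩ := (hS.2.2.2.2.1 p hpS hp).1
  obtain ⟨ν, hν, hen⟩ := hl u (transition_of_edge_place hup hp) μ₀ ⟨[], .nil _⟩
  obtain ⟨ξ, ⟨σ, hσ⟩, hξ⟩ := hhome _ (hν.fire hen)
  obtain ⟨q, ⟨-, hq, hqn⟩, hq1⟩ :=
    marked_trap hσ hZ ⟨p, ⟨hpS, hp, hcon⟩, by simp [fire, hup]⟩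
  refine hqn ⟨0, ?_⟩
  by_contra hqc
  have hqc' : q ∉ cl := hqc
  rw [hξ q hq] at hq1
  simp [clusterMarking, hqc'] at hq1

/-- Transitions of the subnet occurring in an occurrence sequence without way-in transitions also
occur in every sequence that empties the subnet from an enabling equivalent marking. -/
theorem IsCPSubnet.mem_of_enabling_equiv [DecidableEq α] (hS : N.IsCPSubnet S)
    (hpre : ∀ t ∈ N.transitions, ∃ p, N.F p t) {μ₁ μ₂ ν₁ ν₂ : α → ℕ} {σ₁ σ₂ : List α}
    (hen : (N.restrict S).en μ₁ ⊆ (N.restrict S).en μ₂)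
    (h₁ : N.FireSeq μ₁ σ₁ ν₁) (h₂ : N.FireSeq μ₂ σ₂ ν₂) (hway : ∀ t ∈ σ₁, ¬ N.IsWayIn S t)
    (hν₂ : ∀ p ∈ S, p ∈ N.places → ν₂ p = 0) : ∀ t ∈ σ₁, t ∈ S → t ∈ σ₂ := by
  obtain ⟨-, -, -, hbord, htn, -, -⟩ := hS
  induction σ₁ using List.reverseRecOn generalizing ν₁ with
  | nil => simp
  | append_singleton σ a ih =>
    obtain ⟨ξ, hξ, ha⟩ := h₁.of_append
    have ih := ih hξ fun t ht => hway t (List.mem_append_left _ ht)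
    intro t ht htS
    rcases List.mem_append.1 ht with h | h
    · exact ih t h htS
    obtain rfl := List.mem_singleton.1 h
    have hta : N.Enabled ξ t := by
      cases ha with
      | cons h _ => exact h
    have hin : ∀ p, N.F p t → p ∈ S := by
      intro p hpt
      by_contra hpS
      exact hway t ht ⟨htS, hta.1, p, place_of_edge_transition hpt hta.1, hpS, hpt⟩
    have hfin : ∀ p, N.F p t → 1 ≤ μ₂ p + N.insertions p σ₂ → t ∈ σ₂ := by
      intro p hpt h
      have hp := place_of_edge_transition hpt hta.1
      have h1 := h₂.marking_eq p
      rw [hν₂ p (hin p hpt) hp] at h1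
      obtain ⟨u, hu, hpu⟩ := removals_pos.1 (show 0 < N.removals p σ₂ by omega)
      rwa [(htn p (hin p hpt) hp).2.unique ⟨htS, hpt⟩
        ⟨hbord p (hin p hpt) hp u (Or.inr hpu), hpu⟩]
    by_cases hall : ∀ p, N.F p t → 1 ≤ μ₁ p
    · have hmem : t ∈ (N.restrict S).en μ₂ :=
        hen ⟨Finset.mem_inter.2 ⟨hta.1, htS⟩, fun p hp => hall p hp.2.2⟩
      obtain ⟨p, hpt⟩ := hpre t hta.1
      have := hmem.2 p ⟨hin p hpt, htS, hpt⟩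
      exact hfin p hpt (by omega)
    · push Not at hall
      obtain ⟨p, hpt, hp0⟩ := hall
      have hp := place_of_edge_transition hpt hta.1
      have h1 := hξ.marking_eq p
      have h2 := hta.2 p hpt
      obtain ⟨u, hu, hup⟩ := insertions_pos.1 (show 0 < N.insertions p σ by omega)
      have := insertions_pos.2 ⟨u, ih u hu (hbord p (hin p hpt) hp u (Or.inl hup)), hup⟩
      exact hfin p hpt (by omega)

end Net

/-- **Enabling equivalence forces marking equality on adapted CP-subnets.**
Let `(N, μ₀)` be a perpetual free-choice system with regeneration cluster
`cl`, let `S` span a `cl`-adapted CP-subnet, and let `μ₁, μ₂` be reachable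
markings whose restrictions to the subnet are enabling equivalent. Then the
restrictions agree on the places of the subnet. -/
theorem adapted_cpSubnet_enabling_equiv_marking_eq
    {α : Type*} [DecidableEq α] (N : Net α) (μ₀ : α → ℕ) (cl : Set α)
    (hfc : N.FreeChoice) (hperp : N.Perpetual μ₀ cl)
    (S : Finset α) (hS : N.IsCPSubnet S) (had : ¬ cl ⊆ (S : Set α))
    (μ₁ μ₂ : α → ℕ) (h₁ : N.Reach μ₀ μ₁) (h₂ : N.Reach μ₀ μ₂)
    (hen : (N.restrict S).en μ₁ = (N.restrict S).en μ₂) :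
    ∀ p ∈ S, p ∈ N.places → μ₁ p = μ₂ p := by
  intro p hpS hp
  have ⟨hl, hb, hcl, _⟩ := hperp
  have hpre : ∀ t ∈ N.transitions, ∃ q, N.F q t := by
    intro t ht
    by_contra! h
    exact hS.not_isolated hperp had hpS hp ht h fun q => hb.no_post_of_no_pre ht h
  have hpost : ∀ t ∈ N.transitions, ∃ q, N.F t q := by
    intro t ht
    by_contra! h
    exact hS.not_isolated hperp had hpS hp ht (fun q => hb.no_pre_of_no_post hl ht h) h
  obtain ⟨v, hv⟩ := hS.2.2.2.2.2.1
  have hT : N.transitions.Nonempty := ⟨v, (Finset.mem_inter.1 hv).2⟩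
  obtain ⟨A, δ, hA⟩ := Net.exists_isAllocation
    fun q hq => hS.exists_leads hfc hperp had hpre hpost (p := q) hq
  obtain ⟨σ₁, ν₁, hσ₁, hf₁, hν₁⟩ := Net.exists_follows_fireSeq hfc hperp hT hpre hpost hA h₁
  obtain ⟨σ₂, ν₂, hσ₂, hf₂, hν₂⟩ := Net.exists_follows_fireSeq hfc hperp hT hpre hpost hA h₂
  have hway : ∀ {σ : List α} {μ ν : α → ℕ}, N.FireSeq μ σ ν → N.Follows cl A σ →
      ∀ t ∈ σ, ¬ N.IsWayIn S t := by
    intro σ μ ν hσ hf t ht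
    have htT := hσ.mem_transitions t ht
    obtain ⟨q, hq⟩ := hpre t htT
    obtain ⟨hqc, htA⟩ := hf t ht q hq
    rw [htA]
    exact hA.mem q (Net.place_of_edge_transition hq htT) hqc
  have hzero : ∀ {ν : α → ℕ}, N.MarkingEq ν (N.clusterMarking cl) →
      ∀ q ∈ S, q ∈ N.places → ν q = 0 := by
    intro ν hν q hqS hq
    have hqc : q ∉ cl := fun h => hS.cluster_place_not_mem hfc hcl had hq h hqS
    rw [hν q hq]
    simp [Net.clusterMarking, hqc]
  have h12 := hS.mem_of_enabling_equiv hpre hen.le hσ₁ hσ₂ (hway hσ₁ hf₁) (hzero hν₂)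
  have h21 := hS.mem_of_enabling_equiv hpre hen.ge hσ₂ hσ₁ (hway hσ₂ hf₂) (hzero hν₁)
  have hbord := hS.2.2.2.1 p hpS hp
  have hrem : 0 < N.removals p σ₁ ↔ 0 < N.removals p σ₂ := by
    rw [Net.removals_pos, Net.removals_pos]
    exact ⟨fun ⟨t, ht, h⟩ => ⟨t, h12 t ht (hbord t (Or.inr h)), h⟩,
      fun ⟨t, ht, h⟩ => ⟨t, h21 t ht (hbord t (Or.inr h)), h⟩⟩
  have hins : 0 < N.insertions p σ₁ ↔ 0 < N.insertions p σ₂ := by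
    rw [Net.insertions_pos, Net.insertions_pos]
    exact ⟨fun ⟨t, ht, h⟩ => ⟨t, h12 t ht (hbord t (Or.inl h)), h⟩,
      fun ⟨t, ht, h⟩ => ⟨t, h21 t ht (hbord t (Or.inl h)), h⟩⟩
  have e1 := hσ₁.marking_eq p
  have e2 := hσ₂.marking_eq p
  have b1 := hf₁.removals_le_one hA hσ₁ hν₁ hp
  have b2 := hf₂.removals_le_one hA hσ₂ hν₂ hp
  have z1 := hzero hν₁ p hpS hp
  have z2 := hzero hν₂ p hpS hp
  omega
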